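/- arXiv:2009.04492 — 2 statements merged into one kernel-verified Lean document; each statement's English description precedes it below -/
import Mathlib

section
/- Let σ be a probability measure on ℝ, let f(x) = ∫ℝ e^{ixt} dσ(t) be the associated characteristic function (assumed bounded and continuous), let K_f be the modified Cauchy transform of f, and set a_f = ∫ℝ sign(x) e^{−|x|} dσ(x). Then for every y < 0, −K_f(iy) = ∫_{(−∞,0]} e^{−yx} dσ₂(x) + a_f, where σ₂ is the nonnegative finite measure σ₂ = 2·σ restricted to (−∞, 0] minus σ({0})·δ₀. In particular, y ↦ −(a_f + K_f(iy)) is absolutely monotonic on (−∞, 0). -/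
open MeasureTheory Complex Set
open scoped ENNReal ComplexOrder

noncomputable def cauchyTransform (f : ℝ → ℂ) (z : ℂ) : ℂ :=
  (Complex.I / (Real.pi : ℂ)) * ∫ t : ℝ, f t / (z - (t : ℂ))

noncomputable def modCauchyTransform (f : ℝ → ℂ) (z : ℂ) : ℂ :=
  (Complex.I / (Real.pi : ℂ)) *
    ∫ t : ℝ, (1 / (z - (t : ℂ)) + (t : ℂ) / ((t : ℂ) ^ 2 + 1)) * f t

def CompletelyMonotonicOn (ω : ℝ → ℝ) (s : Set ℝ) : Prop :=
  ContDiffOn ℝ (⊤ : ℕ∞) ω s ∧ ∀ (n : ℕ), ∀ x ∈ s, 0 ≤ (-1 : ℝ) ^ n * iteratedDeriv n ω x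

def AbsolutelyMonotonicOn (ω : ℝ → ℝ) (s : Set ℝ) : Prop :=
  ContDiffOn ℝ (⊤ : ℕ∞) ω s ∧ ∀ (n : ℕ), ∀ x ∈ s, 0 ≤ iteratedDeriv n ω x

def IsCharFun (f : ℝ → ℂ) : Prop :=
  ∃ σ : Measure ℝ, IsProbabilityMeasure σ ∧
    ∀ x : ℝ, f x = ∫ t : ℝ, Complex.exp (Complex.I * x * t) ∂σ

noncomputable def kerK (y t : ℝ) : ℂ := 1 / (Complex.I * y - (t : ℂ)) + (t : ℂ) / ((t : ℂ) ^ 2 + 1)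

noncomputable def invH (y s : ℝ) : ℂ :=
  if s ≤ 0 then Complex.exp (s) - 2 * Complex.exp (-y * s) else -Complex.exp (-s)

lemma sq_add_one_ne (t : ℝ) : (t : ℂ) ^ 2 + 1 ≠ 0 := by
  have : (t ^ 2 + 1 : ℝ) ≠ 0 := by positivity
  exact_mod_cast this

lemma iy_sub_ne {y : ℝ} (hy : y < 0) (t : ℝ) : Complex.I * y - (t : ℂ) ≠ 0 := by
  intro h
  have := congrArg Complex.im h
  simp at this
  exact hy.ne this

lemma kerK_continuous {y : ℝ} (hy : y < 0) : Continuous (kerK y) := by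
  unfold kerK
  refine Continuous.add (Continuous.div (by fun_prop) (by fun_prop) (iy_sub_ne hy))
    (Continuous.div (by fun_prop) (by fun_prop) sq_add_one_ne)

lemma kerK_integrable {y : ℝ} (hy : y < 0) : Integrable (kerK y) := by
  refine Integrable.mono' ((integrable_inv_one_add_sq).const_mul (1 / |y| + |y|))
    (kerK_continuous hy).aestronglyMeasurable (Filter.Eventually.of_forall fun t => ?_)
  have e : kerK y t = (1 + Complex.I * (t * y : ℝ)) / (Complex.I * y - t) * ((1 + t ^ 2 : ℝ) : ℂ)⁻¹ := by
    have h1 := sq_add_one_ne t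
    have h2 := iy_sub_ne hy t
    have h3 : (1 : ℂ) + t ^ 2 ≠ 0 := by rwa [add_comm]
    unfold kerK
    push_cast
    rw [add_comm ((t : ℂ) ^ 2) 1]
    field_simp
    ring
  rw [e, norm_mul, norm_inv, Complex.norm_real, Real.norm_of_nonneg (by positivity : (0:ℝ) ≤ 1 + t ^ 2)]
  refine mul_le_mul_of_nonneg_right ?_ (by positivity)
  have hy' : 0 < |y| := abs_pos.2 hy.ne
  have n1 : |y| ≤ ‖Complex.I * y - (t : ℂ)‖ := by
    simpa using Complex.abs_im_le_norm (Complex.I * y - (t : ℂ))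
  have n2 : |t| ≤ ‖Complex.I * y - (t : ℂ)‖ := by
    simpa using Complex.abs_re_le_norm (Complex.I * y - (t : ℂ))
  have n3 : ‖1 + Complex.I * ((t * y : ℝ) : ℂ)‖ ≤ 1 + |t| * |y| := by
    refine (norm_add_le _ _).trans ?_
    rw [norm_mul, Complex.norm_real]; simp
  rw [norm_div, div_le_iff₀ (by linarith)]
  refine n3.trans ?_
  rw [add_mul]
  refine add_le_add ?_ ?_
  · rw [one_div, ← div_eq_inv_mul, le_div_iff₀ hy', one_mul]; exact n1
  · rw [mul_comm]; exact mul_le_mul_of_nonneg_left n2 hy'.le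

lemma invH_continuous (y : ℝ) : Continuous (invH y) := by
  unfold invH
  refine Continuous.if_le (by fun_prop) (by fun_prop) continuous_id continuous_const ?_
  intro x hx
  subst hx
  norm_num

lemma invH_piece {y : ℝ} (hy : y < 0) (w : ℝ) :
    (IntegrableOn (fun s : ℝ => Complex.exp (((-w * s : ℝ) : ℂ) * Complex.I) * invH y s) (Iic 0) ∧
      ∫ s in Iic (0:ℝ), Complex.exp (((-w * s : ℝ) : ℂ) * Complex.I) * invH y s
        = 1 / (1 - w * Complex.I) - 2 * (1 / (-y - w * Complex.I))) ∧
    (IntegrableOn (fun s : ℝ => Complex.exp (((-w * s : ℝ) : ℂ) * Complex.I) * invH y s) (Ioi 0) ∧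
      ∫ s in Ioi (0:ℝ), Complex.exp (((-w * s : ℝ) : ℂ) * Complex.I) * invH y s
        = 1 / (-1 - w * Complex.I)) := by
  have r1 : 0 < (1 - w * Complex.I : ℂ).re := by simp
  have r2 : 0 < (-y - w * Complex.I : ℂ).re := by simpa using hy
  have r3 : (-1 - w * Complex.I : ℂ).re < 0 := by simp
  have i1 := integrableOn_exp_mul_complex_Iic r1 0
  have i2 := (integrableOn_exp_mul_complex_Iic r2 0).const_mul 2
  have i3 := (integrableOn_exp_mul_complex_Ioi r3 0).neg
  have e1 : EqOn (fun s : ℝ => Complex.exp ((1 - w * Complex.I) * s)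
      - 2 * Complex.exp ((-y - w * Complex.I) * s))
      (fun s : ℝ => Complex.exp (((-w * s : ℝ) : ℂ) * Complex.I) * invH y s) (Iic 0) := by
    intro s hs
    have hs' : s ≤ 0 := hs
    simp only [invH, if_pos hs', mul_sub, mul_left_comm _ (2 : ℂ), ← Complex.exp_add]
    push_cast
    ring_nf
  have e2 : EqOn (fun s : ℝ => -Complex.exp ((-1 - w * Complex.I) * s))
      (fun s : ℝ => Complex.exp (((-w * s : ℝ) : ℂ) * Complex.I) * invH y s) (Ioi 0) := by
    intro s hs
    have hs' : ¬ s ≤ 0 := not_le.2 hs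
    simp only [invH, if_neg hs', mul_neg, ← Complex.exp_add]
    push_cast
    ring_nf
  refine ⟨⟨(i1.sub i2).congr_fun e1 measurableSet_Iic, ?_⟩,
    ⟨IntegrableOn.congr_fun i3 e2 measurableSet_Ioi, ?_⟩⟩
  · rw [← setIntegral_congr_fun measurableSet_Iic e1, integral_sub i1 i2, integral_const_mul,
      integral_exp_mul_complex_Iic r1, integral_exp_mul_complex_Iic r2]
    simp
  · rw [← setIntegral_congr_fun measurableSet_Ioi e2, integral_neg,
      integral_exp_mul_complex_Ioi r3]
    simp [neg_div]

lemma invH_integrable {y : ℝ} (hy : y < 0) : Integrable (invH y) := by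
  have h := invH_piece hy 0
  have := h.1.1.union h.2.1
  simpa [Iic_union_Ioi] using this

open scoped FourierTransform in
lemma invH_fourier {y : ℝ} (hy : y < 0) (w : ℝ) :
    𝓕 (invH y) w = 2 * Complex.I * kerK y (2 * Real.pi * w) := by
  rw [Real.fourier_real_eq_integral_exp_smul]
  set v : ℝ := 2 * Real.pi * w with hv
  obtain ⟨⟨i1, j1⟩, ⟨i2, j2⟩⟩ := invH_piece hy v
  have e : ∀ s : ℝ, Complex.exp (((-2 * Real.pi * s * w : ℝ) : ℂ) * Complex.I) • invH y s
      = Complex.exp (((-v * s : ℝ) : ℂ) * Complex.I) * invH y s := by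
    intro s
    rw [smul_eq_mul, hv]; congr 4; ring
  simp_rw [e]
  rw [← setIntegral_univ, ← Iic_union_Ioi (a := (0:ℝ)),
    setIntegral_union (Iic_disjoint_Ioi le_rfl) measurableSet_Ioi i1 i2, j1, j2]
  have h1 := sq_add_one_ne v
  have h2 := iy_sub_ne hy v
  have h3 : (1 - v * Complex.I : ℂ) ≠ 0 := fun h => by simpa using congrArg Complex.re h
  have h4 : (-1 - v * Complex.I : ℂ) ≠ 0 := fun h => by simpa using congrArg Complex.re h
  have h5 : (-y - v * Complex.I : ℂ) = Complex.I * (Complex.I * y - v) := by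
    linear_combination (-y : ℂ) * Complex.I_sq
  have h6 : (v : ℂ) ^ 2 + 1 = -(1 - v * Complex.I) * (-1 - v * Complex.I) := by
    linear_combination ((v:ℂ) ^ 2) * Complex.I_sq
  have h7 : 2 * (1 / (Complex.I * (Complex.I * y - v) )) = - (2 * Complex.I * (1 / (Complex.I * y - (v:ℂ)))) := by
    field_simp
    simp
  unfold kerK
  rw [h5, h7, h6]
  generalize 1 / (Complex.I * y - (v:ℂ)) = q
  have h8 : 1 / (1 - v * Complex.I) + 1 / (-1 - v * Complex.I) = 2 * Complex.I * (v / (-(1 - v * Complex.I) * (-1 - v * Complex.I))) := by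
    field_simp
    ring
  linear_combination h8

open scoped FourierTransform in
lemma kerK_inv {y : ℝ} (hy : y < 0) (s : ℝ) :
    (Complex.I / (Real.pi : ℂ)) * ∫ t : ℝ, kerK y t * Complex.exp (Complex.I * t * s) = invH y s := by
  have hF : 𝓕 (invH y) = fun w : ℝ => 2 * Complex.I * kerK y (2 * Real.pi * w) :=
    funext (invH_fourier hy)
  have hpi : (2 * Real.pi : ℝ) ≠ 0 := by positivity
  have hI : Integrable (𝓕 (invH y)) := by
    rw [hF]
    exact ((kerK_integrable hy).comp_mul_left' hpi).const_mul _
  have := congrFun ((invH_continuous y).fourierInv_fourier_eq (invH_integrable hy) hI) s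
  rw [← this, Real.fourierInv_eq', hF]
  have e : ∀ v : ℝ, Complex.exp (((2 * Real.pi * inner ℝ v s : ℝ) : ℂ) * Complex.I) •
      (2 * Complex.I * kerK y (2 * Real.pi * v)) =
      (2 * Complex.I) * (fun t : ℝ => kerK y t * Complex.exp (Complex.I * t * s)) (2 * Real.pi * v) := by
    intro v
    have : (((2 * Real.pi * inner ℝ v s : ℝ) : ℂ) * Complex.I)
      = Complex.I * ((2 * Real.pi * v : ℝ) : ℂ) * s := by
      simp [inner]; ring
    simp only [this, smul_eq_mul]
    ring
  rw [integral_congr_ae (Filter.Eventually.of_forall e), integral_const_mul,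
    Measure.integral_comp_mul_left (fun t : ℝ => kerK y t * Complex.exp (Complex.I * t * s))]
  rw [abs_of_pos (by positivity), Complex.real_smul]
  push_cast
  have : (Real.pi : ℂ) ≠ 0 := by exact_mod_cast Real.pi_ne_zero
  generalize (∫ t : ℝ, kerK y t * Complex.exp (Complex.I * t * s)) = q
  field_simp

lemma modCauchy_eq (σ : Measure ℝ) [IsProbabilityMeasure σ] (f : ℝ → ℂ)
    (hf : ∀ x : ℝ, f x = ∫ t : ℝ, Complex.exp (Complex.I * x * t) ∂σ) {y : ℝ} (hy : y < 0) :
    modCauchyTransform f (Complex.I * y) = ∫ s, invH y s ∂σ := by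
  have hint : Integrable (Function.uncurry fun t s : ℝ => kerK y t * Complex.exp (Complex.I * t * s))
      (volume.prod σ) := by
    have h1 : Integrable (fun p : ℝ × ℝ => kerK y p.1) (volume.prod σ) :=
      (kerK_integrable hy).comp_fst σ
    have h2 := h1.bdd_mul (f := fun p : ℝ × ℝ => Complex.exp (Complex.I * p.1 * p.2)) (c := 1)
      (by apply Continuous.aestronglyMeasurable; fun_prop)
      (Filter.Eventually.of_forall fun p => by simp [Complex.norm_exp])
    refine h2.congr (Filter.Eventually.of_forall fun p => ?_)
    simp [Function.uncurry, mul_comm]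
  unfold modCauchyTransform
  have e : ∀ t : ℝ, (1 / (Complex.I * y - (t : ℂ)) + (t : ℂ) / ((t : ℂ) ^ 2 + 1)) * f t
      = ∫ s, kerK y t * Complex.exp (Complex.I * t * s) ∂σ := by
    intro t
    rw [hf, integral_const_mul]; rfl
  simp_rw [e]
  rw [integral_integral_swap hint, ← integral_const_mul]
  simp_rw [kerK_inv hy]

lemma sigma2_eq (σ : Measure ℝ) [IsProbabilityMeasure σ] :
    (2 : ℝ≥0∞) • σ.restrict (Iic 0) - σ {0} • Measure.dirac (0 : ℝ)
      = (2 : ℝ≥0∞) • σ.restrict (Iio 0) + σ {0} • Measure.dirac (0 : ℝ) := by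
  have h : σ.restrict (Iic 0) = σ.restrict (Iio 0) + σ {0} • Measure.dirac (0 : ℝ) := by
    rw [← Iio_union_right, Measure.restrict_union (by simp) (measurableSet_singleton _),
      Measure.restrict_singleton]
  have : IsFiniteMeasure (σ {0} • Measure.dirac (0 : ℝ)) :=
    Measure.smul_finite _ (measure_ne_top _ _)
  rw [h, smul_add, two_smul ℝ≥0∞ (σ {0} • Measure.dirac (0 : ℝ)), ← add_assoc,
    Measure.add_sub_cancel]

lemma int_exp_Iio (σ : Measure ℝ) [IsFiniteMeasure σ] {y : ℝ} (hy : y < 0) :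
    IntegrableOn (fun x => Real.exp (-y * x)) (Iic 0) σ := by
  refine Measure.integrableOn_of_bounded (M := 1) (measure_ne_top _ _)
    (by apply Continuous.aestronglyMeasurable; fun_prop) ?_
  filter_upwards [ae_restrict_mem measurableSet_Iic] with x hx
  rw [Real.norm_of_nonneg (Real.exp_pos _).le, Real.exp_le_one_iff]
  exact mul_nonpos_of_nonneg_of_nonpos (by linarith) hx

/-- Necessity computation for Theorem 2, lower half-plane: with
`a_f = ∫ sign(x) e^{-|x|} dσ(x)` and `σ₂ = 2·σ|_{(-∞,0]} - σ({0})·δ₀`, one has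
`-K_f(iy) = ∫_{(-∞,0]} e^{-yx} dσ₂(x) + a_f` for `y < 0`; in particular
`y ↦ -(a_f + K_f(iy))` is absolutely monotonic on `(-∞,0)`. -/
theorem stmt_7 (σ : Measure ℝ) [IsProbabilityMeasure σ] (f : ℝ → ℂ)
    (hf : ∀ x : ℝ, f x = ∫ t : ℝ, Complex.exp (Complex.I * x * t) ∂σ)
    (hc : Continuous f) (hb : ∃ M : ℝ, ∀ x : ℝ, ‖f x‖ ≤ M)
    (a : ℝ) (ha : a = ∫ x : ℝ, Real.sign x * Real.exp (-|x|) ∂σ)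
    (σ₂ : Measure ℝ)
    (hσ₂ : σ₂ = (2 : ℝ≥0∞) • σ.restrict (Iic 0) - σ {0} • Measure.dirac (0 : ℝ)) :
    (∀ y ∈ Iio (0 : ℝ),
        -modCauchyTransform f (Complex.I * y) =
          ((∫ x in Iic (0 : ℝ), Real.exp (-y * x) ∂σ₂ : ℝ) : ℂ) + (a : ℂ)) ∧
      AbsolutelyMonotonicOn
        (fun y : ℝ => (-((a : ℂ) + modCauchyTransform f (Complex.I * y))).re) (Iio 0) := by
  have hfin0 : IsFiniteMeasure (σ {0} • Measure.dirac (0 : ℝ)) :=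
    Measure.smul_finite _ (measure_ne_top _ _)
  have hfin1 : IsFiniteMeasure ((2 : ℝ≥0∞) • σ.restrict (Iio 0)) :=
    Measure.smul_finite _ (by simp)
  rw [sigma2_eq] at hσ₂
  have hfin : IsFiniteMeasure σ₂ := by rw [hσ₂]; infer_instance
  have key : ∀ y ∈ Iio (0 : ℝ),
        -modCauchyTransform f (Complex.I * y) =
          ((∫ x in Iic (0 : ℝ), Real.exp (-y * x) ∂σ₂ : ℝ) : ℂ) + (a : ℂ) := by
    intro y hy
    rw [modCauchy_eq σ f hf hy, ← integral_neg]
    have hI : Integrable (fun x => (Iio (0:ℝ)).indicator (fun x => 2 * Real.exp (-y * x)) x) σ := by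
      rw [integrable_indicator_iff measurableSet_Iio]
      exact (((int_exp_Iio σ hy).mono_set Iio_subset_Iic_self)).const_mul 2
    have hJ : Integrable (fun x => ({0} : Set ℝ).indicator (fun _ => (1:ℝ)) x) σ := by
      rw [integrable_indicator_iff (measurableSet_singleton _)]
      exact integrableOn_const (by simp)
    have hS : Integrable (fun x => Real.sign x * Real.exp (-|x|)) σ := by
      refine Integrable.of_bound (C := 1) ?_ (Filter.Eventually.of_forall fun x => ?_)
      · have : Measurable Real.sign := by
          unfold Real.sign
          refine Measurable.ite measurableSet_Iio measurable_const
            (Measurable.ite measurableSet_Ioi measurable_const measurable_const)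
        exact (this.mul (by fun_prop)).aestronglyMeasurable
      · rw [norm_mul, Real.norm_of_nonneg (Real.exp_pos _).le]
        have h1 : ‖Real.sign x‖ ≤ 1 := by
          rcases Real.sign_apply_eq x with h | h | h <;> simp [h]
        have h2 : Real.exp (-|x|) ≤ 1 := by simp
        exact mul_le_one₀ h1 (Real.exp_pos _).le h2
    have e : ∀ s : ℝ, -invH y s = (((Iio (0:ℝ)).indicator (fun x => 2 * Real.exp (-y * x)) s
        + ({0} : Set ℝ).indicator (fun _ => (1:ℝ)) s + Real.sign s * Real.exp (-|s|) : ℝ) : ℂ) := by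
      intro s
      rcases lt_trichotomy s 0 with h | h | h
      · simp [invH, h, h.le, h.ne, Real.sign_of_neg h, abs_of_neg h]; ring
      · subst h; simp [invH]; norm_num
      · simp [invH, h, h.not_ge, h.le, h.ne', Real.sign_of_pos h, abs_of_pos h]
    simp_rw [e]
    rw [integral_complex_ofReal, ← Complex.ofReal_add]
    congr 1
    have hIJ := hI.add hJ
    simp only [Pi.add_def] at hIJ
    rw [integral_add hIJ hS, ← ha, integral_add hI hJ]
    congr 1
    rw [integral_indicator measurableSet_Iio, integral_indicator (measurableSet_singleton _), hσ₂,
      Measure.restrict_add, Measure.restrict_smul, Measure.restrict_smul,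
      Measure.restrict_restrict measurableSet_Iic,
      inter_eq_self_of_subset_right Iio_subset_Iic_self, MeasureTheory.restrict_dirac' measurableSet_Iic,
      if_pos self_mem_Iic, integral_add_measure, integral_smul_measure, integral_smul_measure]
    · simp [integral_const_mul, Measure.real]
    · exact ((int_exp_Iio σ hy).mono_set Iio_subset_Iic_self).smul_measure (by simp)
    · exact (integrable_dirac (by simp)).smul_measure (measure_ne_top _ _)
  refine ⟨key, ?_⟩
  set μ := σ₂.restrict (Iic 0) with hμ
  have eq : EqOn (fun y : ℝ => (-((a : ℂ) + modCauchyTransform f (Complex.I * y))).re)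
      (ProbabilityTheory.mgf (fun x : ℝ => -x) μ) (Iio 0) := by
    intro y hy
    have := key y hy
    have h2 : -((a : ℂ) + modCauchyTransform f (Complex.I * y))
        = ((∫ x, Real.exp (-y * x) ∂μ : ℝ) : ℂ) := by
      linear_combination this
    simp only [h2, Complex.ofReal_re, ProbabilityTheory.mgf]
    simp
  have sub : Iio (0:ℝ) ⊆ interior (ProbabilityTheory.integrableExpSet (fun x : ℝ => -x) μ) := by
    refine interior_maximal ?_ isOpen_Iio
    intro y hy
    have := int_exp_Iio σ₂ hy
    simpa [ProbabilityTheory.integrableExpSet, IntegrableOn] using this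
  refine ⟨?_, ?_⟩
  · refine ContDiffOn.congr ?_ eq
    exact ((ProbabilityTheory.analyticOnNhd_mgf.mono sub).contDiffOn (uniqueDiffOn_Iio 0))
  · intro n y hy
    have : iteratedDeriv n (fun y : ℝ => (-((a : ℂ) + modCauchyTransform f (Complex.I * y))).re) y
        = iteratedDeriv n (ProbabilityTheory.mgf (fun x : ℝ => -x) μ) y :=
      Filter.EventuallyEq.iteratedDeriv_eq n (eq.eventuallyEq_of_mem (Iio_mem_nhds hy))
    rw [this, ProbabilityTheory.iteratedDeriv_mgf (sub hy)]
    refine integral_nonneg_of_ae ?_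
    filter_upwards [ae_restrict_mem measurableSet_Iic] with x hx
    have : 0 ≤ -x := neg_nonneg.2 hx
    simp only [Pi.zero_apply]
    positivity
end

section
/- Let f : ℝ → ℂ be a bounded continuous function satisfying ∫ℝ |f(t)|/(1 + |t|) dt < ∞, and let k_f be its Cauchy transform. If y ↦ k_f(iy) is real-valued and completely monotonic on (0, ∞) and y ↦ −k_f(iy) is real-valued and absolutely monotonic on (−∞, 0), then for every fixed y > 0 the function x ↦ (P_y ∗ f)(x) = ∫ℝ (1/π)(y/((x − t)² + y²)) f(t) dt is a continuous positive definite function on ℝ. -/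
open MeasureTheory Complex Set
open scoped ENNReal ComplexOrder

def IsPosDefFun (φ : ℝ → ℂ) : Prop :=
  ∀ (n : ℕ) (x : Fin n → ℝ) (c : Fin n → ℂ),
    0 ≤ ∑ i, ∑ j, φ (x i - x j) * c i * (starRingEnd ℂ) (c j)


lemma denom_bound (z0 : ℂ) (hz : z0.im ≠ 0) : ∃ c > 0, ∃ ε > 0, ∀ z ∈ Metric.ball z0 ε, ∀ t : ℝ,
    c * (1 + |t|) ≤ ‖z - (t : ℂ)‖ := by
  set δ := |z0.im| / 2 with hδ
  have hδ0 : 0 < δ := by have := abs_pos.mpr hz; positivity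
  set R := ‖z0‖ + δ with hR
  have hR0 : 0 < R := by positivity
  refine ⟨(1 + (1 + R) / δ)⁻¹, by positivity, δ, hδ0, ?_⟩
  intro z hzb t
  rw [mem_ball_iff_norm] at hzb
  have h1 : δ ≤ ‖z - t‖ := by
    have a1 : |(z - t).im| ≤ ‖z - t‖ := Complex.abs_im_le_norm _
    have a2 : |(z - z0).im| ≤ ‖z - z0‖ := Complex.abs_im_le_norm _
    have a3 : |z0.im| ≤ |z.im| + |(z - z0).im| := by
      have : z0.im = z.im - (z - z0).im := by simp
      calc |z0.im| = |z.im - (z - z0).im| := by rw [← this]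
        _ ≤ _ := abs_sub _ _
    simp only [Complex.sub_im, Complex.ofReal_im, sub_zero] at a1 a2 a3
    linarith
  have h2 : |t| ≤ ‖z - t‖ + R := by
    have b1 : ‖z‖ ≤ ‖z0‖ + ‖z - z0‖ := by
      calc ‖z‖ = ‖z0 + (z - z0)‖ := by congr 1; ring
        _ ≤ _ := norm_add_le _ _
    have b2 : ‖(t : ℂ)‖ ≤ ‖z‖ + ‖z - t‖ := by
      calc ‖(t : ℂ)‖ = ‖z - (z - t)‖ := by congr 1; ring
        _ ≤ _ := norm_sub_le _ _
    rw [Complex.norm_real, Real.norm_eq_abs] at b2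
    linarith
  rw [inv_mul_le_iff₀ (by positivity)]
  have h3 : (1 + R) ≤ (1 + R) / δ * ‖z - t‖ := by
    rw [div_mul_eq_mul_div, le_div_iff₀ hδ0]
    exact mul_le_mul_of_nonneg_left h1 (by positivity)
  linarith

lemma cauchy_integrable (f : ℝ → ℂ) (hc : Continuous f)
    (hint : Integrable (fun t : ℝ => ‖f t‖ / (1 + |t|))) (z : ℂ) (hz : z.im ≠ 0) :
    Integrable (fun t : ℝ => f t / (z - (t : ℂ))) := by
  obtain ⟨c, hc0, ε, hε, hb⟩ := denom_bound z hz
  have hb := hb z (Metric.mem_ball_self hε)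
  have hne : ∀ t : ℝ, z - (t : ℂ) ≠ 0 := by
    intro t h
    have := hb t
    rw [h, norm_zero] at this
    have : 0 < c * (1 + |t|) := by positivity
    linarith
  refine (hint.const_mul c⁻¹).mono' ?_ ?_
  · exact (hc.div (by fun_prop) hne).aestronglyMeasurable
  · refine Filter.Eventually.of_forall fun t => ?_
    rw [norm_div]
    calc ‖f t‖ / ‖z - t‖ ≤ ‖f t‖ / (c * (1 + |t|)) := by
          have := hb t
          gcongr
      _ = _ := by field_simp

lemma cauchy_diff (f : ℝ → ℂ) (hc : Continuous f)
    (hint : Integrable (fun t : ℝ => ‖f t‖ / (1 + |t|))) (z0 : ℂ) (hz : z0.im ≠ 0) :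
    DifferentiableAt ℂ (cauchyTransform f) z0 := by
  obtain ⟨c, hc0, ε, hε, hb⟩ := denom_bound z0 hz
  have hne : ∀ z ∈ Metric.ball z0 ε, ∀ t : ℝ, z - (t : ℂ) ≠ 0 := by
    intro z hz t h
    have := hb z hz t
    rw [h, norm_zero] at this
    have : 0 < c * (1 + |t|) := by positivity
    linarith
  have hz0 := Metric.mem_ball_self (x := z0) hε
  have key := hasDerivAt_integral_of_dominated_loc_of_deriv_le (μ := volume)
    (F := fun (z : ℂ) (t : ℝ) => f t / (z - (t : ℂ)))
    (F' := fun (z : ℂ) (t : ℝ) => - f t / (z - (t : ℂ)) ^ 2)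
    (bound := fun t => (c ^ 2)⁻¹ * (‖f t‖ / (1 + |t|)))
    (Metric.ball_mem_nhds z0 hε) ?_ (cauchy_integrable f hc hint z0 hz) ?_ ?_
    (hint.const_mul _) ?_
  · exact (key.2.differentiableAt).const_mul _
  · filter_upwards [Metric.ball_mem_nhds z0 hε] with z hz
    exact (hc.div (by fun_prop) (hne z hz)).aestronglyMeasurable
  · exact (hc.neg.div (by fun_prop) (fun t => pow_ne_zero 2 (hne z0 hz0 t))).aestronglyMeasurable
  · refine Filter.Eventually.of_forall fun t z hz => ?_
    rw [norm_div, norm_neg, norm_pow]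
    have h1 := hb z hz t
    have h2 : c ^ 2 * (1 + |t|) ≤ ‖z - t‖ ^ 2 := by
      calc c ^ 2 * (1 + |t|) ≤ c ^ 2 * (1 + |t|) ^ 2 := by
            gcongr
            nlinarith [abs_nonneg t]
        _ = (c * (1 + |t|)) ^ 2 := by ring
        _ ≤ _ := by gcongr
    calc ‖f t‖ / ‖z - t‖ ^ 2 ≤ ‖f t‖ / (c ^ 2 * (1 + |t|)) := by gcongr
      _ = _ := by field_simp
  · refine Filter.Eventually.of_forall fun t z hz => ?_
    have := (hasDerivAt_const z (f t)).div ((hasDerivAt_id z).sub_const (t : ℂ)) (hne z hz t)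
    have h : HasDerivAt (fun z : ℂ => f t / (z - (t : ℂ)))
      ((0 * (z - (t : ℂ)) - f t * 1) / (z - (t : ℂ)) ^ 2) z := this
    have e : - f t / (z - (t : ℂ)) ^ 2
        = (0 * (z - (t : ℂ)) - f t * 1) / (z - (t : ℂ)) ^ 2 := by
      rw [zero_mul, mul_one, zero_sub]
    rw [e]
    exact h

lemma iter_real (g : ℂ → ℂ) (hg : DifferentiableOn ℂ g {w | 0 < w.re})
    (him : ∀ y : ℝ, 0 < y → (g y).im = 0) (n : ℕ) :
    DifferentiableOn ℂ (iteratedDeriv n g) {w | 0 < w.re} ∧ ∀ y : ℝ, 0 < y →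
      iteratedDeriv n g y = ((iteratedDeriv n (fun y : ℝ => (g y).re) y : ℝ) : ℂ) := by
  have ho : IsOpen {w : ℂ | 0 < w.re} := isOpen_lt continuous_const Complex.continuous_re
  induction n with
  | zero =>
    refine ⟨by simpa using hg, fun y hy => ?_⟩
    simp only [iteratedDeriv_zero]
    exact Complex.ext (by simp) (by simpa using him y hy)
  | succ n ih =>
    refine ⟨by rw [iteratedDeriv_succ]; exact ih.1.deriv ho, fun y hy => ?_⟩
    rw [iteratedDeriv_succ, iteratedDeriv_succ]
    have hd : HasDerivAt (iteratedDeriv n g) (deriv (iteratedDeriv n g) y) (y : ℂ) :=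
      (ih.1.differentiableAt (ho.mem_nhds (by simpa using hy))).hasDerivAt
    have hd' := hd.comp_ofReal
    have hev : (fun x : ℝ => ((iteratedDeriv n (fun y : ℝ => (g y).re) x : ℝ) : ℂ)) =ᶠ[nhds y]
        (fun x : ℝ => iteratedDeriv n g x) := by
      filter_upwards [Ioi_mem_nhds hy] with x hx
      exact (ih.2 x hx).symm
    have hd2 := hd'.congr_of_eventuallyEq hev
    have hre := (Complex.reCLM.hasFDerivAt.comp_hasDerivAt y hd2)
    have him2 := (Complex.imCLM.hasFDerivAt.comp_hasDerivAt y hd2)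
    have e1 : deriv (iteratedDeriv n (fun y : ℝ => (g y).re)) y
        = (deriv (iteratedDeriv n g) y).re := by
      have : HasDerivAt (iteratedDeriv n (fun y : ℝ => (g y).re))
        ((deriv (iteratedDeriv n g) y).re) y := by simpa [Function.comp_def] using hre
      exact this.deriv
    have e2 : (deriv (iteratedDeriv n g) y).im = 0 := by
      have h0 : HasDerivAt (fun _ : ℝ => (0 : ℝ)) ((deriv (iteratedDeriv n g) y).im) y := by
        simpa [Function.comp_def] using him2
      exact h0.unique (hasDerivAt_const y 0)
    rw [e1]
    exact Complex.ext (by simp) (by simpa using e2)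

lemma step_tendsto (w : ℂ) : Filter.Tendsto
    (fun h : ℝ => ((h : ℂ))⁻¹ * (1 - Complex.exp (-(h * w)))) (nhdsWithin 0 (Ioi 0)) (nhds w) := by
  have h1 : HasDerivAt (fun z : ℂ => 1 - Complex.exp (-(z * w))) w ((0 : ℝ) : ℂ) := by
    have := ((((hasDerivAt_id ((0 : ℝ) : ℂ)).mul_const w).neg).cexp).const_sub 1
    simpa using this
  have := h1.comp_ofReal.tendsto_slope_zero_right
  simpa using this

/-- Holomorphic and completely monotonic on the half-line implies positive definite on
vertical lines. -/
lemma posdef_core (g : ℂ → ℂ) (hg : DifferentiableOn ℂ g {w | 0 < w.re})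
    (him : ∀ y : ℝ, 0 < y → (g y).im = 0)
    (hcm : ∀ (n : ℕ) (y : ℝ), 0 < y → 0 ≤ (-1 : ℝ) ^ n * iteratedDeriv n (fun y : ℝ => (g y).re) y)
    (y : ℝ) (hy : 0 < y) (s : ℝ) :
    IsPosDefFun (fun x : ℝ => g (y + Complex.I * s * x)) := by
  have ho : IsOpen {w : ℂ | 0 < w.re} := isOpen_lt continuous_const Complex.continuous_re
  intro N x c
  set W : Fin N → Fin N → ℂ := fun i j => y + Complex.I * s * ((x i - x j : ℝ) : ℂ) with hW
  have hWre : ∀ i j, (W i j).re = y := by intro i j; simp [hW]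
  have hlim : Filter.Tendsto (fun h : ℝ => ∑ i, ∑ j,
      g (((h : ℂ))⁻¹ * (1 - Complex.exp (-(h * W i j)))) * c i * (starRingEnd ℂ) (c j))
      (nhdsWithin 0 (Ioi 0)) (nhds (∑ i, ∑ j, g (W i j) * c i * (starRingEnd ℂ) (c j))) := by
    refine tendsto_finsetSum _ fun i _ => tendsto_finsetSum _ fun j _ => ?_
    refine Filter.Tendsto.mul_const _ (Filter.Tendsto.mul_const _ ?_)
    have hcont : ContinuousAt g (W i j) :=
      (hg.differentiableAt (ho.mem_nhds (by simp [hWre, hy]))).continuousAt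
    exact hcont.tendsto.comp (step_tendsto _)
  refine ge_of_tendsto hlim ?_
  filter_upwards [self_mem_nhdsWithin] with h hh
  have hh : 0 < h := hh
  have hhc : (h : ℂ) ≠ 0 := by exact_mod_cast hh.ne'
  have hball : DifferentiableOn ℂ g (Metric.ball ((h⁻¹ : ℝ) : ℂ) h⁻¹) := by
    refine hg.mono fun w hw => ?_
    rw [mem_ball_iff_norm] at hw
    have := Complex.abs_re_le_norm (w - (h⁻¹ : ℝ))
    rw [Complex.sub_re, Complex.ofReal_re] at this
    have := (abs_lt.mp (this.trans_lt hw)).1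
    show 0 < w.re
    linarith
  set b : ℕ → ℝ := fun n => ((n.factorial : ℝ))⁻¹ * (h⁻¹) ^ n *
    ((-1 : ℝ) ^ n * iteratedDeriv n (fun y : ℝ => (g y).re) h⁻¹) with hb
  have hb0 : ∀ n, 0 ≤ b n := fun n => by
    have := hcm n h⁻¹ (by positivity)
    positivity
  have hsum : ∀ i j, HasSum (fun n : ℕ => (b n : ℂ) * Complex.exp (-(h * W i j)) ^ n)
      (g (((h : ℂ))⁻¹ * (1 - Complex.exp (-(h * W i j))))) := by
    intro i j
    have hmem : ((h : ℂ))⁻¹ * (1 - Complex.exp (-(h * W i j))) ∈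
        Metric.ball ((h⁻¹ : ℝ) : ℂ) h⁻¹ := by
      rw [mem_ball_iff_norm]
      have : ((h : ℂ))⁻¹ * (1 - Complex.exp (-(h * W i j))) - ((h⁻¹ : ℝ) : ℂ)
          = -(((h⁻¹ : ℝ) : ℂ) * Complex.exp (-(h * W i j))) := by push_cast; ring
      rw [this, norm_neg, norm_mul, Complex.norm_real, Complex.norm_exp, Real.norm_of_nonneg
        (by positivity)]
      have h3 : (-(h * W i j)).re = -(h * y) := by simp [hWre]
      rw [h3]
      have : Real.exp (-(h * y)) < 1 := by
        rw [Real.exp_lt_one_iff]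
        have : 0 < h * y := by positivity
        linarith
      have h4 : 0 < h⁻¹ := by positivity
      nlinarith
    have := Complex.hasSum_taylorSeries_on_ball hball hmem
    refine this.congr_fun ?_ 
    intro n
    rw [(iter_real g hg him n).2 h⁻¹ (by positivity)]
    have e : ((h : ℂ))⁻¹ * (1 - Complex.exp (-(h * W i j))) - ((h⁻¹ : ℝ) : ℂ)
          = (-1) * (((h⁻¹ : ℝ) : ℂ) * Complex.exp (-(h * W i j))) := by push_cast; ring
    rw [e, mul_pow, mul_pow]
    simp only [hb, smul_eq_mul]
    push_cast
    ring
  have htot : HasSum (fun n : ℕ => ∑ i, ∑ j,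
      (b n : ℂ) * Complex.exp (-(h * W i j)) ^ n * c i * (starRingEnd ℂ) (c j)) (∑ i, ∑ j,
      g (((h : ℂ))⁻¹ * (1 - Complex.exp (-(h * W i j)))) * c i * (starRingEnd ℂ) (c j)) :=
    hasSum_sum fun i _ => hasSum_sum fun j _ => ((hsum i j).mul_right _).mul_right _
  refine htot.nonneg fun n => ?_
  set u : Fin N → ℂ := fun i => c i * Complex.exp (-(n * h * s * x i * Complex.I)) with hu
  have hterm : (∑ i, ∑ j,
      (b n : ℂ) * Complex.exp (-(h * W i j)) ^ n * c i * (starRingEnd ℂ) (c j))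
      = ((b n * Real.exp (-(n * h * y)) : ℝ) : ℂ) * ((∑ i, u i) * (starRingEnd ℂ) (∑ i, u i)) := by
    rw [map_sum, Finset.sum_mul_sum, Finset.mul_sum]
    refine Finset.sum_congr rfl fun i _ => ?_
    rw [Finset.mul_sum]
    refine Finset.sum_congr rfl fun j _ => ?_
    have hconj : (starRingEnd ℂ) (u j) = (starRingEnd ℂ) (c j) *
        Complex.exp (n * h * s * x j * Complex.I) := by
      simp only [hu, map_mul, ← Complex.exp_conj, map_neg, Complex.conj_ofReal, Complex.conj_I,
        map_natCast, mul_neg, neg_neg]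
    have hexp : Complex.exp (-(h * W i j)) ^ n = Complex.exp (-(n * h * y)) *
        Complex.exp (-(n * h * s * x i * Complex.I)) *
        Complex.exp (n * h * s * x j * Complex.I) := by
      rw [← Complex.exp_nat_mul, ← Complex.exp_add, ← Complex.exp_add]
      congr 1
      simp only [hW]
      push_cast
      ring
    rw [hconj, hexp]
    simp only [hu]
    push_cast
    ring
  rw [hterm, Complex.mul_conj, ← Complex.ofReal_mul]
  have := hb0 n
  exact_mod_cast mul_nonneg (mul_nonneg this (Real.exp_pos _).le) (Complex.normSq_nonneg _)

/-- Under the monotonicity hypotheses of Theorem 3, for each fixed `y > 0` the Poisson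
average `x ↦ (P_y ∗ f)(x)` is a continuous positive definite function on `ℝ`. -/
theorem stmt_17 (f : ℝ → ℂ) (hc : Continuous f) (hb : ∃ M : ℝ, ∀ x : ℝ, ‖f x‖ ≤ M)
    (hint : Integrable (fun t : ℝ => ‖f t‖ / (1 + |t|)))
    (hre : ∀ y ∈ Ioi (0 : ℝ), (cauchyTransform f (Complex.I * y)).im = 0)
    (hcm : CompletelyMonotonicOn (fun y : ℝ => (cauchyTransform f (Complex.I * y)).re) (Ioi 0))
    (hre' : ∀ y ∈ Iio (0 : ℝ), (-(cauchyTransform f (Complex.I * y))).im = 0)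
    (ham : AbsolutelyMonotonicOn
      (fun y : ℝ => (-(cauchyTransform f (Complex.I * y))).re) (Iio 0)) :
    ∀ y ∈ Ioi (0 : ℝ),
      Continuous (fun x : ℝ =>
          ∫ t : ℝ, (((1 / Real.pi) * (y / ((x - t) ^ 2 + y ^ 2)) : ℝ) : ℂ) * f t) ∧
        IsPosDefFun (fun x : ℝ =>
          ∫ t : ℝ, (((1 / Real.pi) * (y / ((x - t) ^ 2 + y ^ 2)) : ℝ) : ℂ) * f t) := by
  intro y hy
  have hy : 0 < y := hy
  have hP : (fun x : ℝ =>
      ∫ t : ℝ, (((1 / Real.pi) * (y / ((x - t) ^ 2 + y ^ 2)) : ℝ) : ℂ) * f t) =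
      fun x : ℝ => (1 / 2 : ℂ) * (cauchyTransform f (x + Complex.I * y)
        - cauchyTransform f (x - Complex.I * y)) := by
    funext x
    have i1 := cauchy_integrable f hc hint (x + Complex.I * y) (by simp [hy.ne'])
    have i2 := cauchy_integrable f hc hint (x - Complex.I * y) (by simp [hy.ne'])
    unfold cauchyTransform
    rw [← mul_sub, ← integral_sub i1 i2, ← integral_const_mul, ← integral_const_mul]
    congr 1
    funext t
    have hpi : (Real.pi : ℂ) ≠ 0 := by exact_mod_cast Real.pi_ne_zero
    have n1 : (x + Complex.I * y - t : ℂ) ≠ 0 := by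
      intro h; have := congrArg Complex.im h; simp at this; exact hy.ne' this
    have n2 : (x - Complex.I * y - t : ℂ) ≠ 0 := by
      intro h; have := congrArg Complex.im h; simp at this; exact hy.ne' this
    have n3 : ((x - t) ^ 2 + y ^ 2 : ℂ) = (x + Complex.I * y - t) * (x - Complex.I * y - t) := by
      linear_combination (y : ℂ) ^ 2 * Complex.I_sq
    push_cast
    rw [n3]
    have n4 : (x + Complex.I * y - t : ℂ) - (x - Complex.I * y - t) = 2 * Complex.I * y := by ring
    generalize (x + Complex.I * y - t : ℂ) = A at *
    generalize (x - Complex.I * y - t : ℂ) = B at *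
    have n5 : f t / A - f t / B = f t * (-(A - B)) / (A * B) := by
      field_simp
      ring
    rw [n5, n4]
    field_simp
    linear_combination f t * Complex.I_sq
  rw [hP]
  set g1 : ℂ → ℂ := fun w => cauchyTransform f (Complex.I * w) with hg1
  set g2 : ℂ → ℂ := fun w => -cauchyTransform f (-(Complex.I * w)) with hg2
  have d1 : DifferentiableOn ℂ g1 {w | 0 < w.re} := by
    intro w hw
    have hw : 0 < w.re := hw
    have := cauchy_diff f hc hint (Complex.I * w) (by simp [hw.ne'])
    exact (this.comp w (by fun_prop)).differentiableWithinAt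
  have d2 : DifferentiableOn ℂ g2 {w | 0 < w.re} := by
    intro w hw
    have hw : 0 < w.re := hw
    have := cauchy_diff f hc hint (-(Complex.I * w)) (by simp [hw.ne'])
    exact (this.comp w (f := fun w => -(Complex.I * w)) (by fun_prop)).neg.differentiableWithinAt
  have p1 := posdef_core g1 d1 hre (fun n y hy => hcm.2 n y hy) y hy (-1)
  have p2 := posdef_core g2 d2 (fun y hy => by
      have := hre' (-y) (by simpa using hy)
      simpa [hg2] using this) (fun n y hy => by
      have h1 := ham.2 n (-y) (by simpa using hy)
      have h2 := iteratedDeriv_comp_neg n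
        (fun y : ℝ => (-(cauchyTransform f (Complex.I * y))).re) y
      have h3 : (fun x : ℝ => (-(cauchyTransform f (Complex.I * ((-x : ℝ) : ℂ)))).re)
          = fun y : ℝ => (g2 y).re := by
        funext x; simp [hg2]
      rw [h3] at h2
      rw [h2, smul_eq_mul, ← mul_assoc, ← mul_pow]
      simpa using h1) y hy 1
  have hE : ∀ x : ℝ, (1 / 2 : ℂ) * (cauchyTransform f (x + Complex.I * y)
        - cauchyTransform f (x - Complex.I * y)) =
      (1 / 2 : ℂ) * (g1 (y + Complex.I * ((-1 : ℝ) : ℂ) * x)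
        + g2 (y + Complex.I * ((1 : ℝ) : ℂ) * x)) := by
    intro x
    have a1 : Complex.I * (y + Complex.I * ((-1 : ℝ) : ℂ) * x) = x + Complex.I * y := by
      push_cast; linear_combination (-(x : ℂ)) * Complex.I_sq
    have a2 : -(Complex.I * (y + Complex.I * ((1 : ℝ) : ℂ) * x)) = x - Complex.I * y := by
      push_cast; linear_combination (-(x : ℂ)) * Complex.I_sq
    simp only [hg1, hg2]
    rw [a1, a2]
    ring
  refine ⟨?_, ?_⟩
  · refine continuous_iff_continuousAt.mpr fun x => ?_
    have c1 := (cauchy_diff f hc hint (x + Complex.I * y) (by simp [hy.ne'])).continuousAt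
    have c2 := (cauchy_diff f hc hint (x - Complex.I * y) (by simp [hy.ne'])).continuousAt
    have e1 : ContinuousAt (fun x : ℝ => cauchyTransform f (x + Complex.I * y)) x :=
      ContinuousAt.comp (f := fun x : ℝ => (x + Complex.I * y : ℂ)) c1 (by fun_prop)
    have e2 : ContinuousAt (fun x : ℝ => cauchyTransform f (x - Complex.I * y)) x :=
      ContinuousAt.comp (f := fun x : ℝ => (x - Complex.I * y : ℂ)) c2 (by fun_prop)
    exact continuousAt_const.mul (e1.sub e2)
  · intro n x c
    have q1 := p1 n x c
    have q2 := p2 n x c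
    have hs : (∑ i, ∑ j, (fun x : ℝ => (1 / 2 : ℂ) * (cauchyTransform f (x + Complex.I * y)
        - cauchyTransform f (x - Complex.I * y))) (x i - x j) * c i * (starRingEnd ℂ) (c j))
        = ((1 / 2 : ℝ) : ℂ) * ((∑ i, ∑ j, (fun x : ℝ => g1 (y + Complex.I * ((-1 : ℝ) : ℂ) * x))
            (x i - x j) * c i * (starRingEnd ℂ) (c j)) +
          (∑ i, ∑ j, (fun x : ℝ => g2 (y + Complex.I * ((1 : ℝ) : ℂ) * x))
            (x i - x j) * c i * (starRingEnd ℂ) (c j))) := by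
      simp only [hE]
      rw [← Finset.sum_add_distrib, Finset.mul_sum]
      refine Finset.sum_congr rfl fun i _ => ?_
      rw [← Finset.sum_add_distrib, Finset.mul_sum]
      refine Finset.sum_congr rfl fun j _ => ?_
      push_cast
      ring
    rw [hs]
    refine mul_nonneg ?_ (add_nonneg q1 q2)
    exact Complex.zero_le_real.mpr (by norm_num)
end
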